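/- Let α > 1 be real and β ∈ ℂ with Re β > −1. Then, as x → +∞ along the positive real axis, G_{α,β}(x) = e^{−iπ(β+1)/2} Γ(β+1) x^{−(β+1)} + e^{iπ/4} √(2π/(α−1)) · α^{(−1/2−β)/(α−1)} · x^{(β+1−α/2)/(α−1)} · exp(−i α^{−1/(α−1)} (1 − 1/α) x^{α/(α−1)}) + O( x^{−Re β − α − 1} + x^{(Re β + 1 − 3α/2)/(α−1)} ). -/

import Mathlib

open MeasureTheory Set

/-- The entire extension of the Fourier–Laplace transform `F_{α,β}`. -/
noncomputable def Gab (α : ℝ) (β : ℂ) (z : ℂ) : ℂ :=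
  Complex.exp (Complex.I * Real.pi * (β + 1) / (2 * α)) *
    ∫ t in Ioi (0:ℝ), (t : ℂ) ^ β *
      Complex.exp (-(↑(t ^ α) : ℂ) -
        Complex.I * Complex.exp (Complex.I * Real.pi / (2 * α)) * z * t)

/-- The rescaled phase `s ^ α - α s` in the logarithmic variable `w = log s`. -/
noncomputable def logPhase (α : ℝ) (w : ℂ) : ℂ :=
  Complex.exp (α * w) - α * Complex.exp w

/-- The rescaled integrand in the logarithmic variable. -/
noncomputable def logKernel (α : ℝ) (γ : ℂ) (l : ℝ) (w : ℂ) : ℂ :=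
  Complex.exp (γ * w + Complex.I * l * logPhase α w)

lemma logPhase_im (α a b : ℝ) :
    (logPhase α (a + b * Complex.I)).im =
      Real.exp (α * a) * Real.sin (α * b) - α * (Real.exp a * Real.sin b) := by
  simp [logPhase, Complex.exp_im, Complex.exp_re]

lemma norm_logKernel (α : ℝ) (γ : ℂ) (l a b : ℝ) :
    ‖logKernel α γ l (a + b * Complex.I)‖ =
      Real.exp (γ.re * a - γ.im * b - l * (logPhase α (a + b * Complex.I)).im) := by
  rw [logKernel, Complex.norm_exp]
  congr 1
  simp only [Complex.add_re, Complex.mul_re, Complex.add_im, Complex.mul_im, Complex.I_re,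
    Complex.I_im, Complex.ofReal_re, Complex.ofReal_im]
  ring

lemma differentiable_logKernel (α : ℝ) (γ : ℂ) (l : ℝ) :
    Differentiable ℂ (logKernel α γ l) := by
  unfold logKernel logPhase
  fun_prop

lemma continuous_logKernel (α : ℝ) (γ : ℂ) (l : ℝ) : Continuous (logKernel α γ l) :=
  (differentiable_logKernel α γ l).continuous

lemma mul_exp_neg_le_sin {x : ℝ} (hx : 0 ≤ x) (hx' : x ≤ Real.pi / 2) :
    x * Real.exp (-(2 * x)) ≤ Real.sin x := by
  rcases hx.eq_or_lt with rfl | hpos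
  · simp
  have h1 : x - x ^ 3 / 6 < Real.sin x := Real.sin_gt_sub_cube hpos
  have h2 : 1 + 2 * x ≤ Real.exp (2 * x) := by linarith [Real.add_one_le_exp (2 * x)]
  have h3 : x ≤ 1.6 := by linarith [Real.pi_lt_d2]
  have h4 : Real.exp (-(2 * x)) ≤ 1 - x ^ 2 / 6 := by
    rw [Real.exp_neg, inv_le_comm₀ (Real.exp_pos _) (by nlinarith)]
    refine le_trans ?_ h2
    rw [inv_le_iff_one_le_mul₀ (by nlinarith)]
    nlinarith [mul_nonneg hx (sub_nonneg.2 h3), mul_nonneg (mul_nonneg hx hx) (sub_nonneg.2 h3)]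
  nlinarith

lemma sin_mul_le_mul_sin {α x : ℝ} (hα : 1 ≤ α) (hx : 0 ≤ x) (hx' : x ≤ Real.pi / 2) :
    Real.sin (α * x) ≤ α * Real.sin x := by
  have hconc := strictConcaveOn_sin_Icc.concaveOn
  have key : ∀ y : ℝ, 0 ≤ y → y ≤ Real.pi → Real.sin y ≤ α * Real.sin (y / α) := by
    intro y hy hy'
    have hα0 : 0 < α := by linarith
    have h1 : 0 ≤ 1 - 1 / α := by rw [sub_nonneg, div_le_one hα0]; exact hα
    have h2 : 0 ≤ 1 / α := by positivity
    have h := hconc.2 (show (0 : ℝ) ∈ Icc 0 Real.pi from ⟨le_rfl, Real.pi_pos.le⟩)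
      (show y ∈ Icc 0 Real.pi from ⟨hy, hy'⟩) h1 h2 (by ring)
    simp only [smul_eq_mul, mul_zero, Real.sin_zero, zero_add] at h
    rw [show 1 / α * y = y / α by ring] at h
    calc Real.sin y = α * (1 / α * Real.sin y) := by field_simp
      _ ≤ _ := by gcongr
  have hα0 : 0 < α := by linarith
  by_cases hc : α * x ≤ Real.pi
  · simpa [hα0.ne'] using key (α * x) (by positivity) hc
  · push Not at hc
    have h1 : 1 ≤ α * Real.sin (Real.pi / 2 / α) := by
      simpa using key (Real.pi / 2) (by positivity) (by linarith [Real.pi_pos])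
    have h2 : Real.sin (Real.pi / 2 / α) ≤ Real.sin x := by
      apply Real.sin_le_sin_of_le_of_le_pi_div_two
      · have : 0 ≤ Real.pi / 2 / α := by positivity
        linarith [Real.pi_pos]
      · exact hx'
      · rw [div_le_iff₀ hα0]; linarith [Real.pi_pos]
    calc Real.sin (α * x) ≤ 1 := Real.sin_le_one _
      _ ≤ α * Real.sin (Real.pi / 2 / α) := h1
      _ ≤ _ := by gcongr

lemma le_logPhase_im_of_nonneg {α a b : ℝ} (hα : 1 < α) (hb : 0 ≤ b)
    (hb' : α * b ≤ Real.pi / 2) (hab : 2 * (α * b) ≤ (α - 1) * a / 2) :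
    α * b * Real.exp a * ((α - 1) * a / 2) ≤ (logPhase α (a + b * Complex.I)).im := by
  rw [logPhase_im]
  have h0 : 0 ≤ α * b := by positivity
  have h1 := mul_exp_neg_le_sin h0 hb'
  have h2 : Real.sin b ≤ b := Real.sin_le hb
  have h3 : (α - 1) * a / 2 ≤ Real.exp ((α - 1) * a - 2 * (α * b)) - 1 := by
    linarith [Real.add_one_le_exp ((α - 1) * a - 2 * (α * b))]
  calc α * b * Real.exp a * ((α - 1) * a / 2)
      ≤ α * b * Real.exp a * (Real.exp ((α - 1) * a - 2 * (α * b)) - 1) := by gcongr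
    _ = Real.exp (α * a) * (α * b * Real.exp (-(2 * (α * b)))) - α * (Real.exp a * b) := by
      have : Real.exp (α * a) * Real.exp (-(2 * (α * b)))
          = Real.exp a * Real.exp ((α - 1) * a - 2 * (α * b)) := by
        rw [← Real.exp_add, ← Real.exp_add]; ring_nf
      linear_combination (-(α * b)) * this
    _ ≤ _ := by gcongr

lemma le_logPhase_im_of_nonpos {α a b : ℝ} (hα : 1 < α) (ha : a ≤ 0) (hb : b ≤ 0)
    (hb' : -(Real.pi / 2) ≤ b) :
    α * (2 / Real.pi * -b) * (Real.exp a - Real.exp (α * a)) ≤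
      (logPhase α (a + b * Complex.I)).im := by
  rw [logPhase_im]
  have h1 := sin_mul_le_mul_sin hα.le (neg_nonneg.2 hb) (by linarith)
  have h2 := Real.mul_le_sin (neg_nonneg.2 hb) (by linarith)
  rw [mul_neg, Real.sin_neg] at h1
  rw [Real.sin_neg] at h1 h2
  have h3 : Real.exp (α * a) ≤ Real.exp a := Real.exp_le_exp.2 (by nlinarith)
  calc α * (2 / Real.pi * -b) * (Real.exp a - Real.exp (α * a))
      ≤ α * (-Real.sin b) * (Real.exp a - Real.exp (α * a)) := by
        have : 0 ≤ Real.exp a - Real.exp (α * a) := by linarith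
        gcongr
    _ ≤ _ := by
        nlinarith [Real.exp_pos (α * a), mul_le_mul_of_nonneg_left h1 (Real.exp_pos (α * a)).le]

lemma image_exp_univ : Real.exp '' univ = Ioi 0 := by
  rw [image_univ, Real.range_exp]

lemma integral_Ioi_eq_integral_comp_exp (F : ℝ → ℂ) :
    ∫ t in Ioi (0 : ℝ), F t = ∫ τ : ℝ, (Real.exp τ : ℂ) * F (Real.exp τ) := by
  have h := integral_image_eq_integral_abs_deriv_smul MeasurableSet.univ
    (fun x _ => (Real.hasDerivAt_exp x).hasDerivWithinAt) Real.exp_injective.injOn F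
  rw [image_exp_univ] at h
  simpa [abs_of_pos (Real.exp_pos _)] using h

lemma integrable_exp_mul_sub_mul_exp {p r : ℝ} (hp : 0 < p) (hr : 0 < r) :
    Integrable (fun τ : ℝ => Real.exp (p * τ - r * Real.exp τ)) := by
  have h := integrableOn_image_iff_integrableOn_abs_deriv_smul MeasurableSet.univ
    (fun x _ => (Real.hasDerivAt_exp x).hasDerivWithinAt) Real.exp_injective.injOn
    (fun t : ℝ => t ^ (p - 1) * Real.exp (-r * t ^ (1 : ℝ)))
  rw [image_exp_univ] at h
  have h' := h.1 (integrableOn_rpow_mul_exp_neg_mul_rpow (by linarith) one_pos hr)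
  rw [integrableOn_univ] at h'
  refine h'.congr (Filter.Eventually.of_forall fun τ => ?_)
  simp only [abs_of_pos (Real.exp_pos _), smul_eq_mul, Real.rpow_one]
  rw [← Real.exp_mul, ← Real.exp_add, ← Real.exp_add]
  ring_nf

lemma integral_cexp_mul_sub_mul_exp {γ : ℂ} {r : ℝ} (hγ : 0 < γ.re) (hr : 0 < r) :
    ∫ τ : ℝ, Complex.exp (γ * τ - r * Real.exp τ) = (1 / (r : ℂ)) ^ γ * Complex.Gamma γ := by
  rw [← Complex.integral_cpow_mul_exp_neg_mul_Ioi hγ hr, integral_Ioi_eq_integral_comp_exp]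
  refine integral_congr_ae (Filter.Eventually.of_forall fun τ => ?_)
  simp only
  rw [Complex.cpow_def_of_ne_zero (by exact_mod_cast (Real.exp_pos τ).ne'),
    ← Complex.ofReal_log (Real.exp_pos τ).le, Real.log_exp]
  simp only [Complex.ofReal_exp]
  rw [← Complex.exp_add, ← Complex.exp_add]
  ring_nf

lemma integral_exp_mul_sub_mul_exp {p r : ℝ} (hp : 0 < p) (hr : 0 < r) :
    ∫ τ : ℝ, Real.exp (p * τ - r * Real.exp τ) = r ^ (-p) * Real.Gamma p := by
  have h := integral_cexp_mul_sub_mul_exp (γ := (p : ℂ)) (by simpa using hp) hr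
  have h2 : (1 / (r : ℂ)) ^ (p : ℂ) = ((r ^ (-p) : ℝ) : ℂ) := by
    rw [Real.rpow_neg hr.le, ← Real.inv_rpow hr.le, Complex.ofReal_cpow (by positivity)]
    simp
  rw [h2, Complex.Gamma_ofReal] at h
  rw [← Complex.ofReal_inj, ← integral_complex_ofReal, Complex.ofReal_mul, ← h]
  simp

lemma integral_Iic_eq_of_contour {H : ℂ → ℂ} (hH : Differentiable ℂ H) {θ φ a₀ a₁ c : ℝ}
    (hθ : c * a₁ = θ) (hφ : c * a₀ = φ) (hφθ : φ ≤ θ)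
    (hi₁ : IntegrableOn (fun τ : ℝ => H (τ + θ * Complex.I)) (Iic a₁))
    (hi₀ : IntegrableOn (fun τ : ℝ => H (τ + φ * Complex.I)) (Iic a₀))
    {M : ℝ → ℝ} (hM : Filter.Tendsto M Filter.atBot (nhds 0))
    (hHM : ∀ a : ℝ, a ≤ 0 → ∀ b : ℝ, φ ≤ b → b ≤ θ → ‖H (a + b * Complex.I)‖ ≤ M a) :
    ∫ τ in Iic a₁, H (τ + θ * Complex.I) =
      (∫ τ in Iic a₀, H (τ + φ * Complex.I)) +
        ∫ τ in a₀..a₁, (1 + c * Complex.I) * H ((1 + c * Complex.I) * τ) := by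
  obtain ⟨P, hP'⟩ := hH.isExactOn_univ
  have hP : ∀ w, HasDerivAt P (H w) w := fun w => hP' w (mem_univ w)
  have hline : ∀ (b s t : ℝ), ∫ τ in s..t, H (τ + b * Complex.I) =
      P (t + b * Complex.I) - P (s + b * Complex.I) := by
    intro b s t
    refine intervalIntegral.integral_eq_sub_of_hasDerivAt
      (f := fun τ : ℝ => P (τ + b * Complex.I)) (fun τ _ => ?_) ?_
    · have h1 : HasDerivAt (fun w : ℂ => w + b * Complex.I) 1 (τ : ℂ) :=
        (hasDerivAt_id _).add_const _
      simpa using ((hP _).comp _ h1).comp_ofReal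
    · have := hH.continuous
      exact Continuous.intervalIntegrable (by fun_prop) _ _
  have hslant : ∫ τ in a₀..a₁, (1 + c * Complex.I) * H ((1 + c * Complex.I) * τ) =
      P (a₁ + θ * Complex.I) - P (a₀ + φ * Complex.I) := by
    have h := intervalIntegral.integral_eq_sub_of_hasDerivAt (a := a₀) (b := a₁)
      (f := fun τ : ℝ => P ((1 + c * Complex.I) * τ))
      (f' := fun τ : ℝ => (1 + c * Complex.I) * H ((1 + c * Complex.I) * τ)) (fun τ _ => ?_) ?_
    · rw [h, ← hθ, ← hφ]
      push_cast
      congr 2 <;> ring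
    · have h1 : HasDerivAt (fun w : ℂ => (1 + c * Complex.I) * w) (1 + c * Complex.I) (τ : ℂ) := by
        simpa using (hasDerivAt_id (τ : ℂ)).const_mul (1 + c * Complex.I)
      have h2 := ((hP _).comp _ h1).comp_ofReal
      rw [mul_comm (H _)] at h2
      exact h2
    · have := hH.continuous
      exact Continuous.intervalIntegrable (by fun_prop) _ _
  have hvert : Filter.Tendsto (fun a : ℝ => P (a + θ * Complex.I) - P (a + φ * Complex.I))
      Filter.atBot (nhds 0) := by
    have hM' : Filter.Tendsto (fun a => M a * (θ - φ)) Filter.atBot (nhds 0) := by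
      simpa using hM.mul_const (θ - φ)
    refine squeeze_zero_norm' ?_ hM'
    filter_upwards [Filter.eventually_le_atBot 0] with a ha
    have h := (convex_Icc φ θ).norm_image_sub_le_of_norm_hasDerivWithin_le
      (f := fun b : ℝ => P (a + b * Complex.I)) (f' := fun b => H (a + b * Complex.I) * Complex.I)
      (C := M a) (x := φ) (y := θ) (fun b _ => ?_) (fun b hb => ?_)
      ⟨le_rfl, hφθ⟩ ⟨hφθ, le_rfl⟩
    · rwa [Real.norm_of_nonneg (sub_nonneg.2 hφθ)] at h
    · have h1 : HasDerivAt (fun w : ℂ => a + w * Complex.I) Complex.I (b : ℂ) := by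
        simpa using ((hasDerivAt_id (b : ℂ)).mul_const Complex.I).const_add (a : ℂ)
      exact ((hP _).comp _ h1).comp_ofReal.hasDerivWithinAt
    · simpa using hHM a ha b hb.1 hb.2
  have t₁ := intervalIntegral_tendsto_integral_Iic a₁ hi₁ Filter.tendsto_id
  have t₀ := intervalIntegral_tendsto_integral_Iic a₀ hi₀ Filter.tendsto_id
  have t := (t₁.sub t₀).add hvert
  have hconst : (fun a : ℝ => (∫ τ in id a..a₁, H (τ + θ * Complex.I)) -
      (∫ τ in id a..a₀, H (τ + φ * Complex.I)) +
      (P (a + θ * Complex.I) - P (a + φ * Complex.I))) =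
      fun _ => ∫ τ in a₀..a₁, (1 + c * Complex.I) * H ((1 + c * Complex.I) * τ) := by
    funext a
    rw [hline, hline, hslant]
    simp only [id]
    ring
  rw [hconst] at t
  have := tendsto_nhds_unique t tendsto_const_nhds
  rw [← this]
  ring

lemma norm_logKernel_le {α l : ℝ} (hα : 1 < α) (γ : ℂ) (hl : 0 ≤ l) (a b : ℝ) :
    ‖logKernel α γ l (a + b * Complex.I)‖ ≤
      Real.exp (γ.re * a + (|γ.im| * |b| + l * (Real.exp (α * a) + α * Real.exp a))) := by
  rw [norm_logKernel, logPhase_im]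
  apply Real.exp_le_exp.2
  have h1 : -(γ.im * b) ≤ |γ.im| * |b| := by rw [← abs_mul]; exact neg_le_abs _
  have h2 : -(Real.exp (α * a) * Real.sin (α * b)) ≤ Real.exp (α * a) * 1 := by
    rw [← mul_neg]
    gcongr
    linarith [Real.neg_one_le_sin (α * b)]
  have h3 : α * (Real.exp a * Real.sin b) ≤ α * (Real.exp a * 1) := by
    gcongr
    exact Real.sin_le_one b
  have h4 := mul_le_mul_of_nonneg_left (add_le_add h2 h3) hl
  linarith

lemma integrableOn_logKernel_Iic {α l : ℝ} (hα : 1 < α) {γ : ℂ} (hγ : 0 < γ.re) (hl : 0 ≤ l)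
    (b a₁ : ℝ) : IntegrableOn (fun τ : ℝ => logKernel α γ l (τ + b * Complex.I)) (Iic a₁) := by
  have hcont := continuous_logKernel α γ l
  refine Integrable.mono' ((integrableOn_exp_mul_Iic hγ a₁).mul_const
    (Real.exp (|γ.im| * |b| + l * (Real.exp (α * a₁) + α * Real.exp a₁))))
    (Continuous.aestronglyMeasurable (by fun_prop)) ?_
  filter_upwards [ae_restrict_mem measurableSet_Iic] with τ hτ
  refine (norm_logKernel_le hα γ hl τ b).trans ?_
  rw [← Real.exp_add]
  have : τ ≤ a₁ := hτ
  gcongr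

lemma integral_Ioi_exp_le {p r l : ℝ} (hp : 0 < p) (hr : 0 < r) (hl : 1 ≤ l) (a : ℝ) :
    ∫ τ in Ioi a, Real.exp (p * τ - l * r * Real.exp τ) ≤
      Real.exp (-((l - 1) * r * Real.exp a)) * ∫ τ : ℝ, Real.exp (p * τ - r * Real.exp τ) := by
  have hi := integrable_exp_mul_sub_mul_exp hp hr
  have hi' := integrable_exp_mul_sub_mul_exp hp (mul_pos (by linarith : 0 < l) hr)
  rw [← integral_const_mul]
  refine (setIntegral_mono_on hi'.integrableOn (hi.const_mul _).integrableOn measurableSet_Ioi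
    fun τ hτ => ?_).trans (setIntegral_le_integral (hi.const_mul _)
      (Filter.Eventually.of_forall fun τ => by positivity))
  rw [← Real.exp_add]
  apply Real.exp_le_exp.2
  have h1 : Real.exp a ≤ Real.exp τ := Real.exp_le_exp.2 (le_of_lt hτ)
  have h2 : (l - 1) * r * Real.exp a ≤ (l - 1) * r * Real.exp τ :=
    mul_le_mul_of_nonneg_left h1 (mul_nonneg (by linarith) hr.le)
  linarith

lemma exists_exp_neg_le {κ : ℝ} (hκ : 0 < κ) :
    ∃ C, 0 ≤ C ∧ ∀ l : ℝ, 1 ≤ l → Real.exp (-((l - 1) * κ)) ≤ C * l ^ (-(3 / 2) : ℝ) := by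
  refine ⟨Real.exp κ * (2 / κ ^ 2), by positivity, fun l hl => ?_⟩
  have hl0 : 0 < l := by linarith
  have h1 : (κ * l) ^ 2 / 2 ≤ Real.exp (κ * l) := by
    have := Real.quadratic_le_exp_of_nonneg (by positivity : 0 ≤ κ * l)
    nlinarith [mul_pos hκ hl0]
  have h2 : Real.exp (-(κ * l)) ≤ 2 / κ ^ 2 * l ^ (-2 : ℝ) := by
    rw [Real.exp_neg, Real.rpow_neg hl0.le, Real.rpow_two]
    calc (Real.exp (κ * l))⁻¹ ≤ ((κ * l) ^ 2 / 2)⁻¹ := by gcongr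
      _ = _ := by field_simp
  calc Real.exp (-((l - 1) * κ)) = Real.exp κ * Real.exp (-(κ * l)) := by
        rw [← Real.exp_add]; ring_nf
    _ ≤ Real.exp κ * (2 / κ ^ 2 * l ^ (-(3 / 2) : ℝ)) := by
        gcongr
        refine h2.trans ?_
        refine mul_le_mul_of_nonneg_left ?_ (by positivity)
        exact Real.rpow_le_rpow_of_exponent_le hl (by norm_num)
    _ = _ := by ring

lemma exists_integral_Ioi_exp_le {p r : ℝ} (hp : 0 < p) (hr : 0 < r) (a : ℝ) :
    ∃ C, 0 ≤ C ∧ ∀ l : ℝ, 1 ≤ l →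
      ∫ τ in Ioi a, Real.exp (p * τ - l * r * Real.exp τ) ≤ C * l ^ (-(3 / 2) : ℝ) := by
  obtain ⟨C, hC, h⟩ := exists_exp_neg_le (mul_pos hr (Real.exp_pos a))
  have hI : 0 ≤ ∫ τ : ℝ, Real.exp (p * τ - r * Real.exp τ) :=
    integral_nonneg fun τ => (Real.exp_pos _).le
  refine ⟨C * ∫ τ : ℝ, Real.exp (p * τ - r * Real.exp τ), mul_nonneg hC hI, fun l hl => ?_⟩
  refine (integral_Ioi_exp_le hp hr hl a).trans ?_
  rw [mul_right_comm C]
  refine mul_le_mul_of_nonneg_right ?_ hI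
  rw [mul_assoc]
  exact h l hl

lemma logKernel_ray_bound {α l a₁ c τ : ℝ} (hα : 1 < α) (γ : ℂ) (hl : 0 ≤ l)
    (hc : c = (α - 1) / (4 * α)) (ha₁ : c * a₁ = Real.pi / (2 * α)) (hτ : a₁ ≤ τ) :
    ‖logKernel α γ l (τ + (Real.pi / (2 * α) : ℝ) * Complex.I)‖ ≤
      Real.exp (-(γ.im * (Real.pi / (2 * α)))) *
        Real.exp (γ.re * τ - l * (Real.pi ^ 2 / 2) * Real.exp τ) := by
  have hα0 : 0 < α := by linarith
  have h1 : α * (Real.pi / (2 * α)) = Real.pi / 2 := by field_simp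
  have h2 : (α - 1) * a₁ / 2 = Real.pi := by
    rw [hc] at ha₁
    field_simp at ha₁
    linarith
  have hmono : (α - 1) * a₁ / 2 ≤ (α - 1) * τ / 2 := by
    have : 0 < α - 1 := by linarith
    gcongr
  have h := le_logPhase_im_of_nonneg (a := τ) (b := Real.pi / (2 * α)) hα (by positivity)
    h1.le (by rw [h1]; linarith)
  rw [h1] at h
  have h3 : Real.pi ^ 2 / 2 * Real.exp τ ≤ (logPhase α (τ + (Real.pi / (2 * α) : ℝ) *
      Complex.I)).im := by
    refine le_trans ?_ h
    rw [h2] at hmono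
    have : 0 ≤ Real.pi / 2 * Real.exp τ := by positivity
    nlinarith
  rw [norm_logKernel, ← Real.exp_add]
  apply Real.exp_le_exp.2
  have := mul_le_mul_of_nonneg_left h3 hl
  linarith

lemma integrableOn_logKernel_Ioi {α l a₁ c : ℝ} (hα : 1 < α) {γ : ℂ} (hγ : 0 < γ.re)
    (hl : 0 < l) (hc : c = (α - 1) / (4 * α)) (ha₁ : c * a₁ = Real.pi / (2 * α)) :
    IntegrableOn (fun τ : ℝ => logKernel α γ l (τ + (Real.pi / (2 * α) : ℝ) * Complex.I))
      (Ioi a₁) := by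
  have hcont := continuous_logKernel α γ l
  refine Integrable.mono' ((integrable_exp_mul_sub_mul_exp hγ
    (mul_pos hl (by positivity : 0 < Real.pi ^ 2 / 2))).const_mul
    (Real.exp (-(γ.im * (Real.pi / (2 * α)))))).integrableOn
    (Continuous.aestronglyMeasurable (by fun_prop)) ?_
  filter_upwards [ae_restrict_mem measurableSet_Ioi] with τ hτ
  exact logKernel_ray_bound hα γ hl.le hc ha₁ (le_of_lt hτ)

lemma exists_norm_integral_logKernel_Ioi_le {α a₁ c : ℝ} (hα : 1 < α) {γ : ℂ} (hγ : 0 < γ.re)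
    (hc : c = (α - 1) / (4 * α)) (ha₁ : c * a₁ = Real.pi / (2 * α)) :
    ∃ C, 0 ≤ C ∧ ∀ l : ℝ, 1 ≤ l →
      ‖∫ τ in Ioi a₁, logKernel α γ l (τ + (Real.pi / (2 * α) : ℝ) * Complex.I)‖ ≤
        C * l ^ (-(3 / 2) : ℝ) := by
  obtain ⟨C, hC, h⟩ := exists_integral_Ioi_exp_le hγ
    (by positivity : 0 < Real.pi ^ 2 / 2) a₁
  refine ⟨Real.exp (-(γ.im * (Real.pi / (2 * α)))) * C, by positivity, fun l hl => ?_⟩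
  have hl0 : 0 < l := by linarith
  refine (norm_integral_le_of_norm_le ((integrable_exp_mul_sub_mul_exp hγ
    (mul_pos hl0 (by positivity : 0 < Real.pi ^ 2 / 2))).const_mul
    (Real.exp (-(γ.im * (Real.pi / (2 * α)))))).integrableOn (μ := volume.restrict (Ioi a₁))
    ?_).trans ?_
  · filter_upwards [ae_restrict_mem measurableSet_Ioi] with τ hτ
    exact logKernel_ray_bound hα γ hl0.le hc ha₁ (le_of_lt hτ)
  · rw [integral_const_mul, mul_assoc]
    gcongr
    exact h l hl

lemma integral_logKernel_eq {α l a₀ a₁ c : ℝ} (hα : 1 < α) {γ : ℂ} (hγ : 0 < γ.re)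
    (hl : 0 < l) (hc : c = (α - 1) / (4 * α)) (ha₁ : c * a₁ = Real.pi / (2 * α))
    (ha₀ : c * a₀ = -(Real.pi / 2)) :
    ∫ τ : ℝ, logKernel α γ l (τ + (Real.pi / (2 * α) : ℝ) * Complex.I) =
      (∫ τ in Iic a₀, logKernel α γ l (τ + (-(Real.pi / 2) : ℝ) * Complex.I)) +
      (∫ τ in a₀..a₁, (1 + c * Complex.I) * logKernel α γ l ((1 + c * Complex.I) * τ)) +
      ∫ τ in Ioi a₁, logKernel α γ l (τ + (Real.pi / (2 * α) : ℝ) * Complex.I) := by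
  have hα0 : 0 < α := by linarith
  have hθ : Real.pi / (2 * α) ≤ Real.pi / 2 := by
    apply div_le_div_of_nonneg_left Real.pi_pos.le two_pos
    linarith
  have hθ0 : 0 ≤ Real.pi / (2 * α) := by positivity
  rw [← integral_Iic_eq_of_contour (differentiable_logKernel α γ l) ha₁ ha₀
    (by linarith [Real.pi_pos]) (integrableOn_logKernel_Iic hα hγ hl.le _ _)
    (integrableOn_logKernel_Iic hα hγ hl.le _ _)
    (M := fun a => Real.exp (γ.re * a + (|γ.im| * (Real.pi / 2) + l * (1 + α * 1)))),
    intervalIntegral.integral_Iic_add_Ioi (integrableOn_logKernel_Iic hα hγ hl.le _ _)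
      (integrableOn_logKernel_Ioi hα hγ hl hc ha₁)]
  · refine Real.tendsto_exp_atBot.comp ?_
    exact Filter.tendsto_atBot_add_const_right _ _ (Filter.tendsto_id.const_mul_atBot hγ)
  · intro a ha b hb hb'
    refine (norm_logKernel_le hα γ hl.le a b).trans ?_
    have h1 : |b| ≤ Real.pi / 2 := abs_le.2 ⟨hb, by linarith⟩
    have h2 : Real.exp (α * a) ≤ 1 := Real.exp_le_one_iff.2 (by nlinarith)
    have h3 : Real.exp a ≤ 1 := Real.exp_le_one_iff.2 ha
    gcongr

lemma norm_exp_sub_one_le_mul_exp (z : ℂ) : ‖Complex.exp z - 1‖ ≤ ‖z‖ * Real.exp ‖z‖ := by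
  simpa using Complex.norm_exp_sub_sum_le_norm_mul_exp z 1

lemma logKernel_sub_pi_div_two (α l : ℝ) (γ : ℂ) (τ : ℝ) :
    logKernel α γ l (τ + (-(Real.pi / 2) : ℝ) * Complex.I) =
      Complex.exp (-(Complex.I * Real.pi * γ / 2)) *
        (Complex.exp (γ * τ - ((l * α : ℝ) : ℂ) * Real.exp τ) *
        Complex.exp (Complex.I * l *
          Complex.exp (α * (τ + (-(Real.pi / 2) : ℝ) * Complex.I)))) := by
  have h : Complex.exp (τ + (-(Real.pi / 2) : ℝ) * Complex.I) = -Complex.I * Real.exp τ := by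
    rw [Complex.exp_add, show ((-(Real.pi / 2) : ℝ) : ℂ) * Complex.I
      = -Real.pi / 2 * Complex.I by push_cast; ring, Complex.exp_neg_pi_div_two_mul_I]
    push_cast
    ring
  rw [logKernel, logPhase, h, ← Complex.exp_add, ← Complex.exp_add]
  congr 1
  push_cast
  linear_combination (-(l : ℂ) * α * Complex.exp τ) * Complex.I_sq.symm

lemma exists_norm_integral_logKernel_Iic_sub_le {α a₀ : ℝ} (hα : 1 < α) {γ : ℂ}
    (hγ : 0 < γ.re) (ha₀ : a₀ ≤ 0) :
    ∃ C, 0 ≤ C ∧ ∀ l : ℝ, 1 ≤ l →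
      ‖(∫ τ in Iic a₀, logKernel α γ l (τ + (-(Real.pi / 2) : ℝ) * Complex.I)) -
        Complex.exp (-(Complex.I * Real.pi * γ / 2)) *
          ((1 / ((l * α : ℝ) : ℂ)) ^ γ * Complex.Gamma γ)‖ ≤
        C * (l ^ (1 - γ.re - α) + l ^ (-(3 / 2) : ℝ)) := by
  have hα0 : 0 < α := by linarith
  have hα1 : 0 < α - 1 := by linarith
  have hp : 0 < γ.re + α := by linarith
  obtain ⟨C, hC, h⟩ := exists_integral_Ioi_exp_le hγ hα0 a₀
  set E := Complex.exp (-(Complex.I * Real.pi * γ / 2)) with hE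
  set D := (α - 1) ^ (-(γ.re + α)) * Real.Gamma (γ.re + α) with hD
  have hD0 : 0 ≤ D := mul_nonneg (by positivity) (Real.Gamma_pos_of_pos hp).le
  refine ⟨‖E‖ * (D + C), by positivity, fun l hl => ?_⟩
  have hl0 : 0 < l := by linarith
  have hnorm : ∀ τ : ℝ, ‖Complex.exp (γ * τ - ((l * α : ℝ) : ℂ) * Real.exp τ)‖ =
      Real.exp (γ.re * τ - l * α * Real.exp τ) := by
    intro τ
    rw [Complex.norm_exp]
    congr 1
    rw [Complex.sub_re, ← Complex.ofReal_mul, Complex.re_mul_ofReal, Complex.ofReal_re]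
  have hreal := integrable_exp_mul_sub_mul_exp hγ (mul_pos hl0 hα0)
  have hfull : Integrable fun τ : ℝ =>
      Complex.exp (γ * τ - ((l * α : ℝ) : ℂ) * Real.exp τ) :=
    Integrable.mono' hreal (Continuous.aestronglyMeasurable (by fun_prop))
      (Filter.Eventually.of_forall fun τ => (hnorm τ).le)
  have hsplit := intervalIntegral.integral_Iic_add_Ioi (b := a₀) hfull.integrableOn
    hfull.integrableOn
  rw [integral_cexp_mul_sub_mul_exp hγ (mul_pos hl0 hα0)] at hsplit
  have hdecomp : (∫ τ in Iic a₀, logKernel α γ l (τ + (-(Real.pi / 2) : ℝ) * Complex.I)) -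
      E * ((1 / ((l * α : ℝ) : ℂ)) ^ γ * Complex.Gamma γ) =
      (∫ τ in Iic a₀, (logKernel α γ l (τ + (-(Real.pi / 2) : ℝ) * Complex.I) -
        E * Complex.exp (γ * τ - ((l * α : ℝ) : ℂ) * Real.exp τ))) -
      E * ∫ τ in Ioi a₀, Complex.exp (γ * τ - ((l * α : ℝ) : ℂ) * Real.exp τ) := by
    rw [integral_sub (integrableOn_logKernel_Iic hα hγ hl0.le _ _)
      (hfull.const_mul _).integrableOn, integral_const_mul, ← hsplit]
    ring
  have hint := integrable_exp_mul_sub_mul_exp hp (mul_pos hl0 hα1)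
  have hleft : ‖∫ τ in Iic a₀, (logKernel α γ l (τ + (-(Real.pi / 2) : ℝ) * Complex.I) -
        E * Complex.exp (γ * τ - ((l * α : ℝ) : ℂ) * Real.exp τ))‖ ≤
      ‖E‖ * (D * l ^ (1 - γ.re - α)) := by
    calc _ ≤ ∫ τ in Iic a₀, ‖E‖ * l *
          Real.exp ((γ.re + α) * τ - l * (α - 1) * Real.exp τ) := by
          refine norm_integral_le_of_norm_le (hint.const_mul _).integrableOn ?_
          filter_upwards [ae_restrict_mem measurableSet_Iic] with τ hτ
          have hτ0 : τ ≤ 0 := le_trans hτ ha₀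
          rw [logKernel_sub_pi_div_two, ← hE, ← mul_sub, norm_mul, ← mul_sub_one, norm_mul,
            hnorm, mul_assoc ‖E‖ l]
          refine mul_le_mul_of_nonneg_left ?_ (norm_nonneg E)
          have hz : ‖Complex.I * l * Complex.exp (α * (τ + (-(Real.pi / 2) : ℝ) *
              Complex.I))‖ = l * Real.exp (α * τ) := by
            rw [norm_mul, norm_mul, Complex.norm_I, Complex.norm_real, one_mul,
              Real.norm_of_nonneg hl0.le, Complex.norm_exp, Complex.re_ofReal_mul]
            simp
          refine (mul_le_mul_of_nonneg_left (norm_exp_sub_one_le_mul_exp _)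
            (Real.exp_pos _).le).trans ?_
          rw [hz]
          have h1 : Real.exp (α * τ) ≤ Real.exp τ := Real.exp_le_exp.2 (by nlinarith)
          calc _ = l * Real.exp ((γ.re * τ - l * α * Real.exp τ) + α * τ +
                l * Real.exp (α * τ)) := by
                rw [Real.exp_add, Real.exp_add]; ring
            _ ≤ _ := by
                refine mul_le_mul_of_nonneg_left (Real.exp_le_exp.2 ?_) hl0.le
                nlinarith [mul_le_mul_of_nonneg_left h1 hl0.le]
      _ ≤ ∫ τ : ℝ, ‖E‖ * l *
          Real.exp ((γ.re + α) * τ - l * (α - 1) * Real.exp τ) :=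
          setIntegral_le_integral (hint.const_mul _)
            (Filter.Eventually.of_forall fun τ => by positivity)
      _ = ‖E‖ * (D * l ^ (1 - γ.re - α)) := by
          rw [integral_const_mul, integral_exp_mul_sub_mul_exp hp (mul_pos hl0 hα1),
            Real.mul_rpow hl0.le hα1.le, hD,
            show 1 - γ.re - α = 1 + -(γ.re + α) by ring, Real.rpow_add hl0, Real.rpow_one]
          ring
  have hright : ‖E * ∫ τ in Ioi a₀, Complex.exp (γ * τ - ((l * α : ℝ) : ℂ) * Real.exp τ)‖ ≤
      ‖E‖ * (C * l ^ (-(3 / 2) : ℝ)) := by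
    rw [norm_mul]
    refine mul_le_mul_of_nonneg_left ?_ (norm_nonneg _)
    refine (norm_integral_le_of_norm_le hreal.integrableOn
      (Filter.Eventually.of_forall fun τ => (hnorm τ).le)).trans (h l hl)
  rw [hdecomp]
  refine (norm_sub_le _ _).trans ((add_le_add hleft hright).trans ?_)
  have h1 : 0 ≤ l ^ (1 - γ.re - α) := by positivity
  have h2 : 0 ≤ l ^ (-(3 / 2) : ℝ) := by positivity
  rw [← mul_add, mul_assoc ‖E‖ (D + C)]
  refine mul_le_mul_of_nonneg_left ?_ (norm_nonneg E)
  nlinarith [mul_nonneg hD0 h2, mul_nonneg hC h1]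

lemma exists_logPhase_taylor {α : ℝ} (hα : 1 < α) (M : ℝ) :
    ∃ D, 0 ≤ D ∧ ∀ w : ℂ, ‖w‖ ≤ M →
      ‖logPhase α w - (1 - α) - ((α * (α - 1) / 2 : ℝ) : ℂ) * w ^ 2‖ ≤ D * ‖w‖ ^ 3 ∧
      ‖logPhase α w - (1 - α) - ((α * (α - 1) / 2 : ℝ) : ℂ) * w ^ 2 -
        (((α ^ 3 - α) / 6 : ℝ) : ℂ) * w ^ 3‖ ≤ D * ‖w‖ ^ 4 := by
  have hα0 : 0 < α := by linarith
  have hn : ∀ w : ℂ, ‖(α : ℂ) * w‖ = α * ‖w‖ := fun w => by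
    rw [norm_mul, Complex.norm_real, Real.norm_of_nonneg hα0.le]
  refine ⟨α ^ 4 * Real.exp (α * M) + α * Real.exp M, by positivity, fun w hw => ⟨?_, ?_⟩⟩
  · have h1 := Complex.norm_exp_sub_sum_le_norm_mul_exp (α * w) 3
    have h2 := Complex.norm_exp_sub_sum_le_norm_mul_exp w 3
    simp only [Finset.sum_range_succ, Finset.sum_range_zero, hn, Nat.factorial] at h1 h2
    set P := Complex.exp (α * w) - _ with hP
    set Q := Complex.exp w - _ with hQ
    have h : logPhase α w - (1 - α) - ((α * (α - 1) / 2 : ℝ) : ℂ) * w ^ 2 = P - α * Q := by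
      rw [logPhase, hP, hQ]; push_cast; ring
    rw [h]
    calc ‖P - α * Q‖ ≤ ‖P‖ + α * ‖Q‖ := (norm_sub_le _ _).trans (by rw [hn])
      _ ≤ (α * ‖w‖) ^ 3 * Real.exp (α * ‖w‖) + α * (‖w‖ ^ 3 * Real.exp ‖w‖) := by gcongr
      _ ≤ (α * ‖w‖) ^ 3 * Real.exp (α * M) + α * (‖w‖ ^ 3 * Real.exp M) := by gcongr
      _ = (α ^ 3 * Real.exp (α * M) + α * Real.exp M) * ‖w‖ ^ 3 := by ring
      _ ≤ _ := by
        gcongr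
        · exact hα.le
        · norm_num
  · have h1 := Complex.norm_exp_sub_sum_le_norm_mul_exp (α * w) 4
    have h2 := Complex.norm_exp_sub_sum_le_norm_mul_exp w 4
    simp only [Finset.sum_range_succ, Finset.sum_range_zero, hn, Nat.factorial] at h1 h2
    set P := Complex.exp (α * w) - _ with hP
    set Q := Complex.exp w - _ with hQ
    have h : logPhase α w - (1 - α) - ((α * (α - 1) / 2 : ℝ) : ℂ) * w ^ 2 -
        (((α ^ 3 - α) / 6 : ℝ) : ℂ) * w ^ 3 = P - α * Q := by
      rw [logPhase, hP, hQ]; push_cast; ring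
    rw [h]
    calc ‖P - α * Q‖ ≤ ‖P‖ + α * ‖Q‖ := (norm_sub_le _ _).trans (by rw [hn])
      _ ≤ (α * ‖w‖) ^ 4 * Real.exp (α * ‖w‖) + α * (‖w‖ ^ 4 * Real.exp ‖w‖) := by gcongr
      _ ≤ (α * ‖w‖) ^ 4 * Real.exp (α * M) + α * (‖w‖ ^ 4 * Real.exp M) := by gcongr
      _ = _ := by ring

lemma norm_exp_sub_one_sub_id_le_max (z : ℂ) :
    ‖Complex.exp z - 1 - z‖ ≤ ‖z‖ ^ 2 * max 1 (Real.exp z.re) := by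
  have hmax : ∀ u ∈ segment ℝ 0 z, Real.exp u.re ≤ max 1 (Real.exp z.re) ∧ ‖u‖ ≤ ‖z‖ := by
    rintro u ⟨a, b, ha, hb, hab, rfl⟩
    simp only [smul_zero, zero_add, Complex.real_smul, Complex.re_ofReal_mul, norm_mul,
      Complex.norm_real, Real.norm_of_nonneg hb]
    refine ⟨?_, by nlinarith [norm_nonneg z]⟩
    rcases le_total z.re 0 with h | h
    · exact le_max_of_le_left (Real.exp_le_one_iff.2 (by nlinarith))
    · exact le_max_of_le_right (Real.exp_le_exp.2 (by nlinarith))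
  have h1 : ∀ u ∈ segment ℝ 0 z, ‖Complex.exp u - 1‖ ≤ max 1 (Real.exp z.re) * ‖z‖ := by
    intro u hu
    have h := (convex_segment (𝕜 := ℝ) (0 : ℂ) z).norm_image_sub_le_of_norm_hasDerivWithin_le
      (f := Complex.exp) (f' := Complex.exp) (C := max 1 (Real.exp z.re)) (x := 0) (y := u)
      (fun v _ => (Complex.hasDerivAt_exp v).hasDerivWithinAt)
      (fun v hv => by rw [Complex.norm_exp]; exact (hmax v hv).1) (left_mem_segment ℝ _ _) hu
    rw [Complex.exp_zero, sub_zero] at h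
    exact h.trans (mul_le_mul_of_nonneg_left (hmax u hu).2 (by positivity))
  have h := (convex_segment (𝕜 := ℝ) (0 : ℂ) z).norm_image_sub_le_of_norm_hasDerivWithin_le
    (f := fun v => Complex.exp v - 1 - v) (f' := fun v => Complex.exp v - 1) (x := 0) (y := z)
    (fun v _ => (((Complex.hasDerivAt_exp v).sub_const 1).sub
      (hasDerivAt_id v)).hasDerivWithinAt) h1 (left_mem_segment ℝ _ _) (right_mem_segment ℝ _ _)
  simp only [Complex.exp_zero, sub_zero, sub_self] at h
  linarith

lemma exists_mul_sq_le_logPhase_im {α a₀ a₁ c : ℝ} (hα : 1 < α)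
    (hc : c = (α - 1) / (4 * α)) (ha₁ : c * a₁ = Real.pi / (2 * α))
    (ha₀ : c * a₀ = -(Real.pi / 2)) :
    ∃ κ, 0 < κ ∧ ∀ τ, a₀ ≤ τ → τ ≤ a₁ →
      κ * τ ^ 2 ≤ (logPhase α (τ + (c * τ : ℝ) * Complex.I)).im := by
  have hα0 : 0 < α := by linarith
  have hα1 : 0 < α - 1 := by linarith
  have hc0 : 0 < c := by rw [hc]; positivity
  set κ₁ := α * c * ((α - 1) / 2) with hκ₁
  set κ₀ := α * (2 / Real.pi * c) * (Real.exp (α * a₀) * (α - 1)) with hκ₀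
  have h1 : 0 < κ₁ := by positivity
  have h0 : 0 < κ₀ := by positivity
  refine ⟨min κ₁ κ₀, lt_min h1 h0, fun τ hτ₀ hτ₁ => ?_⟩
  rcases le_total 0 τ with hτ | hτ
  · refine (mul_le_mul_of_nonneg_right (min_le_left _ _) (sq_nonneg τ)).trans ?_
    have hb : c * τ ≤ Real.pi / (2 * α) := ha₁ ▸ mul_le_mul_of_nonneg_left hτ₁ hc0.le
    refine le_trans ?_ (le_logPhase_im_of_nonneg hα (mul_nonneg hc0.le hτ) ?_ ?_)
    · have : 1 ≤ Real.exp τ := Real.one_le_exp hτ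
      calc κ₁ * τ ^ 2 = α * (c * τ) * 1 * ((α - 1) * τ / 2) := by rw [hκ₁]; ring
        _ ≤ _ := by gcongr
    · calc α * (c * τ) ≤ α * (Real.pi / (2 * α)) := by gcongr
        _ = _ := by field_simp
    · rw [hc]
      apply le_of_eq
      field_simp
      norm_num
  · refine (mul_le_mul_of_nonneg_right (min_le_right _ _) (sq_nonneg τ)).trans ?_
    have hb : -(Real.pi / 2) ≤ c * τ := ha₀ ▸ mul_le_mul_of_nonneg_left hτ₀ hc0.le
    refine le_trans ?_ (le_logPhase_im_of_nonpos hα hτ (mul_nonpos_of_nonneg_of_nonpos hc0.le hτ)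
      hb)
    have h2 : Real.exp (α * a₀) * ((α - 1) * -τ) ≤ Real.exp τ - Real.exp (α * τ) := by
      have h3 : Real.exp τ = Real.exp (α * τ) * Real.exp ((α - 1) * -τ) := by
        rw [← Real.exp_add]; ring_nf
      have h4 : Real.exp (α * a₀) ≤ Real.exp (α * τ) :=
        Real.exp_le_exp.2 (mul_le_mul_of_nonneg_left hτ₀ hα0.le)
      have h5 := Real.add_one_le_exp ((α - 1) * -τ)
      have h6 : 0 ≤ (α - 1) * -τ := mul_nonneg hα1.le (by linarith)
      calc _ ≤ Real.exp (α * τ) * (Real.exp ((α - 1) * -τ) - 1) := by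
            gcongr
            linarith
        _ = _ := by rw [h3]; ring
    calc κ₀ * τ ^ 2 = α * (2 / Real.pi * -(c * τ)) * (Real.exp (α * a₀) * ((α - 1) * -τ)) := by
          rw [hκ₀]; ring
      _ ≤ _ := by
          refine mul_le_mul_of_nonneg_left h2 ?_
          have : 0 ≤ -(c * τ) := by nlinarith
          positivity

/-- The Gaussian-weighted majorant controlling the remainder in Laplace's method. -/
noncomputable def laplaceMajorant (κ l τ : ℝ) : ℝ :=
  Real.exp (-(l * κ * τ ^ 2)) * (τ ^ 2 + l * τ ^ 4 + l ^ 2 * τ ^ 6)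

lemma laplaceMajorant_nonneg {l : ℝ} (hl : 0 ≤ l) (κ τ : ℝ) : 0 ≤ laplaceMajorant κ l τ := by
  unfold laplaceMajorant
  positivity

lemma integrable_pow_mul_exp_neg_mul_sq {b : ℝ} (hb : 0 < b) (n : ℕ) :
    Integrable fun τ : ℝ => τ ^ n * Real.exp (-b * τ ^ 2) := by
  have := integrable_rpow_mul_exp_neg_mul_sq hb (s := n) (by
    have : (0 : ℝ) ≤ n := n.cast_nonneg
    linarith)
  simpa only [Real.rpow_natCast] using this

lemma integrable_laplaceMajorant {κ l : ℝ} (hκ : 0 < κ) (hl : 0 < l) :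
    Integrable (laplaceMajorant κ l) := by
  have hb : 0 < l * κ := by positivity
  have h := ((integrable_pow_mul_exp_neg_mul_sq hb 2).add
    ((integrable_pow_mul_exp_neg_mul_sq hb 4).const_mul l)).add
    ((integrable_pow_mul_exp_neg_mul_sq hb 6).const_mul (l ^ 2))
  refine h.congr (Filter.Eventually.of_forall fun τ => ?_)
  simp only [laplaceMajorant, Pi.add_apply, neg_mul]
  ring

lemma integral_laplaceMajorant {l : ℝ} (κ : ℝ) (hl : 0 < l) :
    ∫ τ, laplaceMajorant κ l τ = (∫ τ, laplaceMajorant κ 1 τ) * l ^ (-(3 / 2) : ℝ) := by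
  have hs : Real.sqrt l ^ 2 = l := Real.sq_sqrt hl.le
  have hs0 : 0 < Real.sqrt l := Real.sqrt_pos.2 hl
  have h : ∀ τ, laplaceMajorant κ l τ = l⁻¹ * laplaceMajorant κ 1 (Real.sqrt l * τ) := by
    intro τ
    simp only [laplaceMajorant, mul_pow]
    rw [show Real.sqrt l ^ 4 = l ^ 2 by rw [← hs]; ring_nf; rw [hs],
      show Real.sqrt l ^ 6 = l ^ 3 by rw [← hs]; ring_nf; rw [hs], hs]
    field_simp
  simp_rw [h]
  rw [integral_const_mul, Measure.integral_comp_mul_left, smul_eq_mul,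
    abs_of_pos (by positivity)]
  have : l ^ (-(3 / 2) : ℝ) = l⁻¹ * (Real.sqrt l)⁻¹ := by
    rw [show (-(3 / 2) : ℝ) = -1 + -(1 / 2) by norm_num, Real.rpow_add hl, Real.rpow_neg_one,
      Real.rpow_neg hl.le, Real.sqrt_eq_rpow]
  rw [this]
  ring

/-- The local model of the integrand at the saddle point: a Gaussian times the first-order
Taylor polynomial of the remaining exponential, in the coordinate `w = τ e`. -/
noncomputable def saddleModel (α : ℝ) (γ e : ℂ) (l τ : ℝ) : ℂ :=
  Complex.exp (Complex.I * l * ((α * (α - 1) / 2 : ℝ) * (e * τ) ^ 2)) *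
    (1 + (γ * (e * τ) + Complex.I * l * ((((α ^ 3 - α) / 6 : ℝ) : ℂ) * (e * τ) ^ 3)))

lemma norm_saddleModel_gaussian (α c l τ : ℝ) :
    ‖Complex.exp (Complex.I * l * ((α * (α - 1) / 2 : ℝ) * ((1 + c * Complex.I) * τ) ^ 2))‖ =
      Real.exp (-(l * (c * (α * (α - 1))) * τ ^ 2)) := by
  rw [Complex.norm_exp]
  congr 1
  rw [show Complex.I * l * (((α * (α - 1) / 2 : ℝ) : ℂ) * ((1 + c * Complex.I) * τ) ^ 2) =
    ((l * (α * (α - 1) / 2) * τ ^ 2 : ℝ) : ℂ) * (Complex.I * (1 + c * Complex.I) ^ 2) by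
      push_cast; ring, Complex.re_ofReal_mul]
  have : (Complex.I * (1 + c * Complex.I) ^ 2).re = -(2 * c) := by
    simp [pow_two]
    ring
  rw [this]
  ring

lemma exists_norm_logKernel_sub_saddleModel_le {α a₀ a₁ c κ : ℝ} (hα : 1 < α) (γ : ℂ)
    (hκc : κ ≤ c * (α * (α - 1)))
    (h : ∀ τ, a₀ ≤ τ → τ ≤ a₁ → κ * τ ^ 2 ≤ (logPhase α (τ + (c * τ : ℝ) * Complex.I)).im) :
    ∃ C, 0 ≤ C ∧ ∀ l : ℝ, 0 ≤ l → ∀ τ, a₀ ≤ τ → τ ≤ a₁ →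
      ‖Complex.exp (-(Complex.I * l * (1 - α))) * logKernel α γ l ((1 + c * Complex.I) * τ) -
        saddleModel α γ (1 + c * Complex.I) l τ‖ ≤ C * laplaceMajorant κ l τ := by
  set e : ℂ := 1 + c * Complex.I with he
  set m := max |a₀| |a₁| with hm
  obtain ⟨D, hD, hT⟩ := exists_logPhase_taylor hα (‖e‖ * m)
  set A := ‖γ‖ * ‖e‖ with hA
  set B := D * ‖e‖ ^ 3 with hB
  set L := Real.exp (A * m) with hL
  have hA0 : 0 ≤ A := by positivity
  have hB0 : 0 ≤ B := by positivity
  have hm0 : 0 ≤ m := le_max_of_le_left (abs_nonneg _)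
  refine ⟨2 * L * (A ^ 2 + B ^ 2) + D * ‖e‖ ^ 4, by positivity, fun l hl τ hτ₀ hτ₁ => ?_⟩
  set w : ℂ := e * τ with hw
  have hτm : |τ| ≤ m := abs_le_max_abs_abs hτ₀ hτ₁
  have hwn : ‖w‖ = ‖e‖ * |τ| := by rw [hw, norm_mul, Complex.norm_real, Real.norm_eq_abs]
  obtain ⟨hT3, hT4⟩ := hT w (by rw [hwn]; gcongr)
  set R := logPhase α w - (1 - α) - ((α * (α - 1) / 2 : ℝ) : ℂ) * w ^ 2 with hR
  set G := Complex.exp (Complex.I * l * ((α * (α - 1) / 2 : ℝ) * w ^ 2)) with hG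
  set z := γ * w + Complex.I * l * R with hz
  have hlI : ‖Complex.I * (l : ℂ)‖ = l := by
    rw [norm_mul, Complex.norm_I, one_mul, Complex.norm_real, Real.norm_of_nonneg hl]
  have hGz : Complex.exp (-(Complex.I * l * (1 - α))) * logKernel α γ l w =
      G * Complex.exp z := by
    rw [logKernel, hG, ← Complex.exp_add, ← Complex.exp_add, hz, hR]
    congr 1
    ring
  have hnormG : ‖G‖ ≤ Real.exp (-(l * κ * τ ^ 2)) := by
    rw [hG, hw, norm_saddleModel_gaussian]
    apply Real.exp_le_exp.2
    have : l * κ * τ ^ 2 ≤ l * (c * (α * (α - 1))) * τ ^ 2 := by gcongr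
    linarith
  have hwform : w = τ + (c * τ : ℝ) * Complex.I := by rw [hw, he]; push_cast; ring
  have hnormGz : ‖G * Complex.exp z‖ ≤ L * Real.exp (-(l * κ * τ ^ 2)) := by
    have h0 : ‖Complex.exp (-(Complex.I * l * (1 - α)))‖ = 1 := by
      rw [Complex.norm_exp, Real.exp_eq_one_iff]
      simp
    rw [← hGz, norm_mul, h0, one_mul, logKernel, Complex.norm_exp, hL, ← Real.exp_add]
    apply Real.exp_le_exp.2
    have h1 : (γ * w).re ≤ A * m := by
      refine (Complex.re_le_norm _).trans ?_
      rw [norm_mul, hwn, hA, mul_assoc]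
      gcongr
    have h2 : (Complex.I * l * logPhase α w).re = -(l * (logPhase α w).im) := by
      simp [Complex.mul_re]
    have h3 := mul_le_mul_of_nonneg_left (hwform ▸ h τ hτ₀ hτ₁) hl
    rw [Complex.add_re, h2]
    linarith
  have hL1 : 1 ≤ L := Real.one_le_exp (by positivity)
  have hmax : ‖G‖ * max 1 (Real.exp z.re) ≤ L * Real.exp (-(l * κ * τ ^ 2)) := by
    rw [mul_max_of_nonneg _ _ (norm_nonneg _), mul_one]
    refine max_le (hnormG.trans ?_) ?_
    · exact le_mul_of_one_le_left (Real.exp_pos _).le hL1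
    · rwa [← Complex.norm_exp, ← norm_mul]
  have hzn : ‖z‖ ≤ A * |τ| + l * B * |τ| ^ 3 := by
    refine (norm_add_le _ _).trans ?_
    rw [norm_mul γ, norm_mul (Complex.I * l), hlI, hwn]
    rw [hwn] at hT3
    have := mul_le_mul_of_nonneg_left hT3 hl
    rw [hA, hB]
    calc _ ≤ ‖γ‖ * (‖e‖ * |τ|) + l * (D * (‖e‖ * |τ|) ^ 3) := by linarith
      _ = _ := by ring
  have hz2 : ‖z‖ ^ 2 ≤ 2 * (A ^ 2 + B ^ 2) * (τ ^ 2 + l ^ 2 * τ ^ 6) := by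
    have h1 : ‖z‖ ^ 2 ≤ (A * |τ| + l * B * |τ| ^ 3) ^ 2 :=
      pow_le_pow_left₀ (norm_nonneg _) hzn 2
    have h2 : |τ| ^ 6 = τ ^ 6 := (show Even 6 by decide).pow_abs τ
    calc _ ≤ _ := h1
      _ ≤ 2 * ((A * |τ|) ^ 2 + (l * B * |τ| ^ 3) ^ 2) := by
          nlinarith [sq_nonneg (A * |τ| - l * B * |τ| ^ 3)]
      _ = 2 * (A ^ 2 * τ ^ 2 + B ^ 2 * (l ^ 2 * τ ^ 6)) := by
          rw [← h2, ← sq_abs τ]; ring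
      _ ≤ _ := by
          have h3 : 0 ≤ τ ^ 2 := by positivity
          have h4 : 0 ≤ l ^ 2 * τ ^ 6 := by positivity
          nlinarith [mul_nonneg (sq_nonneg A) h4, mul_nonneg (sq_nonneg B) h3]
  have hsplit : Complex.exp (-(Complex.I * l * (1 - α))) * logKernel α γ l w -
      saddleModel α γ e l τ = G * (Complex.exp z - 1 - z) +
        G * (Complex.I * l * (R - (((α ^ 3 - α) / 6 : ℝ) : ℂ) * w ^ 3)) := by
    rw [hGz, saddleModel, ← hw, ← hG, hz]
    ring
  have hfirst : ‖G * (Complex.exp z - 1 - z)‖ ≤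
      2 * L * (A ^ 2 + B ^ 2) * laplaceMajorant κ l τ := by
    rw [norm_mul]
    calc _ ≤ ‖G‖ * (‖z‖ ^ 2 * max 1 (Real.exp z.re)) := by
          gcongr
          exact norm_exp_sub_one_sub_id_le_max z
      _ = ‖z‖ ^ 2 * (‖G‖ * max 1 (Real.exp z.re)) := by ring
      _ ≤ (2 * (A ^ 2 + B ^ 2) * (τ ^ 2 + l * τ ^ 4 + l ^ 2 * τ ^ 6)) *
          (L * Real.exp (-(l * κ * τ ^ 2))) := by
          refine mul_le_mul (hz2.trans ?_) hmax (by positivity) (by positivity)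
          have : 0 ≤ l * τ ^ 4 := by positivity
          gcongr
          linarith
      _ = _ := by rw [laplaceMajorant]; ring
  have hsecond : ‖G * (Complex.I * l * (R - (((α ^ 3 - α) / 6 : ℝ) : ℂ) * w ^ 3))‖ ≤
      D * ‖e‖ ^ 4 * laplaceMajorant κ l τ := by
    rw [norm_mul, norm_mul, hlI]
    rw [hwn, mul_pow ‖e‖, (show Even 4 by decide).pow_abs τ] at hT4
    calc _ ≤ Real.exp (-(l * κ * τ ^ 2)) * (l * (D * (‖e‖ ^ 4 * τ ^ 4))) := by gcongr
      _ = D * ‖e‖ ^ 4 * (Real.exp (-(l * κ * τ ^ 2)) * (l * τ ^ 4)) := by ring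
      _ ≤ _ := by
          rw [laplaceMajorant]
          gcongr
          have : 0 ≤ τ ^ 2 := by positivity
          have : 0 ≤ l ^ 2 * τ ^ 6 := by positivity
          linarith
  rw [hsplit, add_mul]
  exact (norm_add_le _ _).trans (add_le_add hfirst hsecond)

lemma exists_norm_saddleModel_le {α c κ m : ℝ} (hα : 1 < α) (γ : ℂ) (hm : 0 < m)
    (hκc : κ ≤ c * (α * (α - 1))) :
    ∃ C, 0 ≤ C ∧ ∀ l : ℝ, 0 ≤ l → ∀ τ, m ≤ |τ| →
      ‖saddleModel α γ (1 + c * Complex.I) l τ‖ ≤ C * laplaceMajorant κ l τ := by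
  set e : ℂ := 1 + c * Complex.I with he
  set A := ‖γ‖ * ‖e‖ with hA
  have hk : 0 ≤ (α ^ 3 - α) / 6 := by
    have : 0 ≤ α ^ 3 - α := by
      nlinarith [mul_pos (by linarith : 0 < α) (by nlinarith : 0 < α ^ 2 - 1)]
    positivity
  set B := (α ^ 3 - α) / 6 * ‖e‖ ^ 3 with hB
  have hA0 : 0 ≤ A := by positivity
  have hB0 : 0 ≤ B := by positivity
  refine ⟨1 / m ^ 2 + A / m + B / m, by positivity, fun l hl τ hτ => ?_⟩
  have hlI : ‖Complex.I * (l : ℂ)‖ = l := by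
    rw [norm_mul, Complex.norm_I, one_mul, Complex.norm_real, Real.norm_of_nonneg hl]
  have hτ0 : 0 ≤ |τ| := abs_nonneg τ
  have hone : 1 ≤ |τ| / m := (one_le_div hm).2 hτ
  have hpoly : ‖1 + (γ * (e * τ) + Complex.I * l *
      ((((α ^ 3 - α) / 6 : ℝ) : ℂ) * (e * τ) ^ 3))‖ ≤
      (1 / m ^ 2 + A / m + B / m) * (τ ^ 2 + l * τ ^ 4 + l ^ 2 * τ ^ 6) := by
    refine (norm_add_le _ _).trans ((add_le_add le_rfl (norm_add_le _ _)).trans ?_)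
    rw [norm_one, norm_mul, norm_mul (Complex.I * l), hlI, norm_mul, norm_mul, norm_pow,
      norm_mul, Complex.norm_real, Complex.norm_real, Real.norm_of_nonneg hk, Real.norm_eq_abs]
    have e2 : |τ| ^ 2 = τ ^ 2 := sq_abs τ
    have e4 : |τ| ^ 4 = τ ^ 4 := (show Even 4 by decide).pow_abs τ
    have h1 : 1 ≤ 1 / m ^ 2 * τ ^ 2 := by
      calc (1 : ℝ) ≤ (|τ| / m) ^ 2 := one_le_pow₀ hone
        _ = _ := by rw [div_pow, e2]; ring
    have h2 : A * |τ| ≤ A / m * τ ^ 2 := by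
      calc A * |τ| ≤ A * |τ| * (|τ| / m) := le_mul_of_one_le_right (by positivity) hone
        _ = _ := by rw [← e2]; ring
    have h3 : l * (B * |τ| ^ 3) ≤ B / m * (l * τ ^ 4) := by
      calc l * (B * |τ| ^ 3) ≤ l * (B * |τ| ^ 3) * (|τ| / m) :=
            le_mul_of_one_le_right (by positivity) hone
        _ = _ := by rw [← e4]; ring
    have h4 : 0 ≤ τ ^ 2 := by positivity
    have h5 : 0 ≤ l * τ ^ 4 := by positivity
    have h6 : 0 ≤ l ^ 2 * τ ^ 6 := by positivity
    have g1 : 0 ≤ 1 / m ^ 2 := by positivity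
    have g2 : 0 ≤ A / m := by positivity
    have g3 : 0 ≤ B / m := by positivity
    calc _ = 1 + (A * |τ| + l * (B * |τ| ^ 3)) := by rw [hA, hB]; ring
      _ ≤ 1 / m ^ 2 * τ ^ 2 + (A / m * τ ^ 2 + B / m * (l * τ ^ 4)) := by gcongr
      _ ≤ _ := by
        have k1 := mul_nonneg (add_nonneg g1 g2) h5
        have k2 := mul_nonneg (add_nonneg (add_nonneg g1 g2) g3) h6
        have k3 := mul_nonneg g3 h4
        nlinarith
  rw [saddleModel, norm_mul, he, norm_saddleModel_gaussian, ← he]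
  calc _ ≤ Real.exp (-(l * κ * τ ^ 2)) * ((1 / m ^ 2 + A / m + B / m) *
        (τ ^ 2 + l * τ ^ 4 + l ^ 2 * τ ^ 6)) := by
        gcongr
    _ = _ := by rw [laplaceMajorant]; ring

lemma integrable_pow_mul_cexp_neg_mul_sq {b : ℂ} (hb : 0 < b.re) (n : ℕ) :
    Integrable fun τ : ℝ => (τ : ℂ) ^ n * Complex.exp (-b * τ ^ 2) := by
  refine (integrable_pow_mul_exp_neg_mul_sq hb n).mono
    (Continuous.aestronglyMeasurable (by fun_prop)) (Filter.Eventually.of_forall fun τ => ?_)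
  simp only [norm_mul, norm_pow, Complex.norm_real, Complex.norm_exp, Real.norm_eq_abs,
    Real.abs_exp]
  apply le_of_eq
  congr 2
  rw [← Complex.ofReal_pow, Complex.re_mul_ofReal, Complex.neg_re]

lemma integral_pow_mul_cexp_neg_mul_sq_of_odd (b : ℂ) {n : ℕ} (hn : Odd n) :
    ∫ τ : ℝ, (τ : ℂ) ^ n * Complex.exp (-b * τ ^ 2) = 0 := by
  have h := integral_neg_eq_self (fun τ : ℝ => (τ : ℂ) ^ n * Complex.exp (-b * τ ^ 2)) volume
  simp only [Complex.ofReal_neg, hn.neg_pow, neg_sq, neg_mul, integral_neg] at h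
  simp only [neg_mul]
  exact self_eq_neg.1 h.symm

lemma integral_add_add {f g h : ℝ → ℂ} (hf : Integrable f) (hg : Integrable g)
    (hh : Integrable h) :
    ∫ τ, (f τ + g τ + h τ) = (∫ τ, f τ) + (∫ τ, g τ) + ∫ τ, h τ := by
  rw [integral_add (f := fun τ => f τ + g τ) (hf.add hg) hh, integral_add hf hg]

section SaddleIntegral

variable {α c l : ℝ}

lemma saddle_exponent_re_pos (hα : 1 < α) (hc : 0 < c) (hl : 0 < l) :
    0 < (-(Complex.I * l * (α * (α - 1) / 2 : ℝ) * (1 + c * Complex.I) ^ 2)).re := by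
  have hα0 : 0 < α := by linarith
  have hα1 : 0 < α - 1 := by linarith
  have h : -(Complex.I * l * (α * (α - 1) / 2 : ℝ) * (1 + c * Complex.I) ^ 2) =
      ((l * (α * (α - 1) / 2) : ℝ) : ℂ) * (-(Complex.I * (1 + c * Complex.I) ^ 2)) := by
    push_cast
    ring
  have h2 : (-(Complex.I * (1 + c * Complex.I) ^ 2)).re = 2 * c := by
    simp [pow_two]
    ring
  rw [h, Complex.re_ofReal_mul, h2]
  positivity

lemma saddleModel_eq (α : ℝ) (γ e : ℂ) (l τ : ℝ) :
    saddleModel α γ e l τ =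
      (τ : ℂ) ^ 0 * Complex.exp (-(-(Complex.I * l * (α * (α - 1) / 2 : ℝ) * e ^ 2)) * τ ^ 2) +
      γ * e * ((τ : ℂ) ^ 1 *
        Complex.exp (-(-(Complex.I * l * (α * (α - 1) / 2 : ℝ) * e ^ 2)) * τ ^ 2)) +
      Complex.I * l * ((α ^ 3 - α) / 6 : ℝ) * e ^ 3 * ((τ : ℂ) ^ 3 *
        Complex.exp (-(-(Complex.I * l * (α * (α - 1) / 2 : ℝ) * e ^ 2)) * τ ^ 2)) := by
  have h : Complex.I * l * (((α * (α - 1) / 2 : ℝ) : ℂ) * (e * τ) ^ 2) =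
      -(-(Complex.I * l * (α * (α - 1) / 2 : ℝ) * e ^ 2)) * τ ^ 2 := by ring
  rw [saddleModel, h]
  ring

lemma integrable_saddleModel (hα : 1 < α) (γ : ℂ) (hc : 0 < c) (hl : 0 < l) :
    Integrable (saddleModel α γ (1 + c * Complex.I) l) := by
  have hb := saddle_exponent_re_pos hα hc hl
  rw [show saddleModel α γ (1 + c * Complex.I) l = fun τ => _ from
    funext (saddleModel_eq α γ (1 + c * Complex.I) l)]
  exact ((integrable_pow_mul_cexp_neg_mul_sq hb 0).add
    ((integrable_pow_mul_cexp_neg_mul_sq hb 1).const_mul _)).add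
    ((integrable_pow_mul_cexp_neg_mul_sq hb 3).const_mul _)

lemma integral_saddleModel (hα : 1 < α) (γ : ℂ) (hc : 0 < c) (hl : 0 < l) :
    (1 + c * Complex.I) * ∫ τ, saddleModel α γ (1 + c * Complex.I) l τ =
      Complex.exp (Complex.I * Real.pi / 4) * Real.sqrt (2 * Real.pi / (α * (α - 1) * l)) := by
  have hb := saddle_exponent_re_pos hα hc hl
  have hα0 : 0 < α := by linarith
  have hα1 : 0 < α - 1 := by linarith
  set e : ℂ := 1 + c * Complex.I with he
  have he0 : e ≠ 0 := by
    intro h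
    have := congrArg Complex.re h
    simp [he] at this
  set S := Real.sqrt (2 * Real.pi / (α * (α - 1) * l)) with hS
  have hS0 : 0 < S := Real.sqrt_pos.2 (by positivity)
  have hS2 : S ^ 2 = 2 * Real.pi / (α * (α - 1) * l) := Real.sq_sqrt (by positivity)
  simp_rw [saddleModel_eq]
  rw [integral_add_add (integrable_pow_mul_cexp_neg_mul_sq hb 0)
    ((integrable_pow_mul_cexp_neg_mul_sq hb 1).const_mul _)
    ((integrable_pow_mul_cexp_neg_mul_sq hb 3).const_mul _), integral_const_mul,
    integral_const_mul, integral_pow_mul_cexp_neg_mul_sq_of_odd _ odd_one,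
    integral_pow_mul_cexp_neg_mul_sq_of_odd _ (by decide : Odd 3)]
  simp only [pow_zero, one_mul, mul_zero, add_zero]
  rw [integral_gaussian_complex hb]
  set ζ : ℂ := Complex.exp (Complex.I * Real.pi / 4) * S / e with hζ
  have hexp : Complex.exp (Complex.I * Real.pi / 4) =
      ((Real.sqrt 2 / 2 : ℝ) : ℂ) * (1 + Complex.I) := by
    rw [show Complex.I * Real.pi / 4 = ((Real.pi / 4 : ℝ) : ℂ) * Complex.I by push_cast; ring,
      Complex.exp_mul_I, ← Complex.ofReal_cos, ← Complex.ofReal_sin, Real.cos_pi_div_four,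
      Real.sin_pi_div_four]
    ring
  have hζre : 0 < ζ.re := by
    have h1 : ζ = ((Real.sqrt 2 / 2 * S : ℝ) : ℂ) * ((1 + Complex.I) / e) := by
      rw [hζ, hexp]; push_cast; ring
    have h2 : ((1 + Complex.I) / e).re = (1 + c) / Complex.normSq e := by
      rw [Complex.div_re, he]
      simp
      ring
    rw [h1, Complex.re_ofReal_mul, h2]
    have : 0 < Complex.normSq e := Complex.normSq_pos.2 he0
    positivity
  have hζsq : ζ ^ 2 = Real.pi / (-(Complex.I * l * (α * (α - 1) / 2 : ℝ) * e ^ 2)) := by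
    have h1 : Complex.exp (Complex.I * Real.pi / 4) ^ 2 = Complex.I := by
      rw [← Complex.exp_nat_mul, show ((2 : ℕ) : ℂ) * (Complex.I * Real.pi / 4) =
        Real.pi / 2 * Complex.I by push_cast; ring, Complex.exp_pi_div_two_mul_I]
    have h2 : (S : ℂ) ^ 2 = 2 * Real.pi / (α * (α - 1) * l) := by exact_mod_cast hS2
    have n1 : (α : ℂ) ≠ 0 := by exact_mod_cast hα0.ne'
    have n2 : (α : ℂ) - 1 ≠ 0 := by exact_mod_cast hα1.ne'
    have n3 : (l : ℂ) ≠ 0 := by exact_mod_cast hl.ne'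
    rw [hζ, div_pow, mul_pow, h1, h2]
    push_cast
    field_simp
    rw [Complex.I_sq]
  rw [← hζsq, one_div, Complex.sq_cpow_two_inv hζre, hζ]
  field_simp

end SaddleIntegral

lemma exists_norm_integral_saddle_sub_le {α a₀ a₁ c : ℝ} (hα : 1 < α) (γ : ℂ)
    (hc : c = (α - 1) / (4 * α)) (ha₁ : c * a₁ = Real.pi / (2 * α))
    (ha₀ : c * a₀ = -(Real.pi / 2)) :
    ∃ C, 0 ≤ C ∧ ∀ l : ℝ, 1 ≤ l →
      ‖(∫ τ in a₀..a₁, (1 + c * Complex.I) * logKernel α γ l ((1 + c * Complex.I) * τ)) -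
        Complex.exp (Complex.I * l * (1 - α)) * (Complex.exp (Complex.I * Real.pi / 4) *
          Real.sqrt (2 * Real.pi / (α * (α - 1) * l)))‖ ≤ C * l ^ (-(3 / 2) : ℝ) := by
  have hα0 : 0 < α := by linarith
  have hα1 : 0 < α - 1 := by linarith
  have hc0 : 0 < c := by rw [hc]; positivity
  have ha₁0 : 0 < a₁ := by
    refine pos_of_mul_pos_right ?_ hc0.le
    rw [ha₁]
    positivity
  have ha₀0 : a₀ < 0 := by
    by_contra! h
    have := mul_nonneg hc0.le h
    linarith [Real.pi_pos]
  obtain ⟨κ', hκ', hbound'⟩ := exists_mul_sq_le_logPhase_im hα hc ha₁ ha₀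
  set κ := min κ' (c * (α * (α - 1))) with hκdef
  have hκ : 0 < κ := lt_min hκ' (by positivity)
  have hκc : κ ≤ c * (α * (α - 1)) := min_le_right _ _
  obtain ⟨C₁, hC₁, h₁⟩ := exists_norm_logKernel_sub_saddleModel_le (a₀ := a₀) (a₁ := a₁) hα γ hκc
    fun τ hτ₀ hτ₁ => (mul_le_mul_of_nonneg_right (min_le_left _ _) (sq_nonneg τ)).trans
      (hbound' τ hτ₀ hτ₁)
  obtain ⟨C₂, hC₂, h₂⟩ := exists_norm_saddleModel_le (m := min (-a₀) a₁) hα γ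
    (lt_min (by linarith) ha₁0) hκc
  set e : ℂ := 1 + c * Complex.I with he
  have hI : 0 ≤ ∫ τ, laplaceMajorant κ 1 τ :=
    integral_nonneg (laplaceMajorant_nonneg zero_le_one κ)
  refine ⟨‖e‖ * ((C₁ + C₂) * ∫ τ, laplaceMajorant κ 1 τ), by positivity, fun l hl => ?_⟩
  have hl0 : 0 < l := by linarith
  set u := Complex.exp (-(Complex.I * l * (1 - α))) with hu
  set v := Complex.exp (Complex.I * l * (1 - α)) with hv
  have hvu : v * u = 1 := by rw [hv, hu, ← Complex.exp_add, add_neg_cancel, Complex.exp_zero]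
  have hvn : ‖v‖ = 1 := by
    rw [hv, Complex.norm_exp, Real.exp_eq_one_iff]
    simp
  set F : ℝ → ℂ := (Ioc a₀ a₁).indicator fun τ => u * logKernel α γ l (e * τ) with hF
  have hcont := continuous_logKernel α γ l
  have hFint : Integrable F := by
    rw [hF, integrable_indicator_iff measurableSet_Ioc]
    exact (Continuous.integrableOn_Icc (by fun_prop)).mono_set Ioc_subset_Icc_self
  have hmodel := integrable_saddleModel hα γ hc0 hl0
  have hrewrite : (∫ τ in a₀..a₁, e * logKernel α γ l (e * τ)) -
      v * (Complex.exp (Complex.I * Real.pi / 4) *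
        Real.sqrt (2 * Real.pi / (α * (α - 1) * l))) =
      v * (e * ∫ τ, (F τ - saddleModel α γ e l τ)) := by
    rw [← integral_saddleModel hα γ hc0 hl0, integral_sub hFint hmodel, hF,
      integral_indicator measurableSet_Ioc, intervalIntegral.integral_of_le (by linarith),
      integral_const_mul, integral_const_mul]
    linear_combination (-(e * ∫ τ in Ioc a₀ a₁, logKernel α γ l (e * τ))) * hvu
  have hpoint : ∀ τ, ‖F τ - saddleModel α γ e l τ‖ ≤ (C₁ + C₂) * laplaceMajorant κ l τ := by
    intro τ
    have hmaj := laplaceMajorant_nonneg hl0.le κ τ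
    by_cases hτ : τ ∈ Ioc a₀ a₁
    · rw [hF, indicator_of_mem hτ]
      refine (h₁ l hl0.le τ hτ.1.le hτ.2).trans ?_
      exact mul_le_mul_of_nonneg_right (by linarith) hmaj
    · rw [hF, indicator_of_notMem hτ, zero_sub, norm_neg]
      refine (h₂ l hl0.le τ ?_).trans (mul_le_mul_of_nonneg_right (by linarith) hmaj)
      rw [mem_Ioc, not_and_or, not_lt, not_le] at hτ
      rcases hτ with hτ | hτ
      · exact (min_le_left _ _).trans ((neg_le_neg hτ).trans (neg_le_abs τ))
      · exact (min_le_right _ _).trans (hτ.le.trans (le_abs_self τ))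
  rw [hrewrite, norm_mul, hvn, one_mul, norm_mul, mul_assoc ‖e‖]
  refine mul_le_mul_of_nonneg_left ?_ (norm_nonneg e)
  calc _ ≤ ∫ τ, (C₁ + C₂) * laplaceMajorant κ l τ :=
        norm_integral_le_of_norm_le ((integrable_laplaceMajorant hκ hl0).const_mul _)
          (Filter.Eventually.of_forall hpoint)
    _ = _ := by rw [integral_const_mul, integral_laplaceMajorant κ hl0, mul_assoc]

lemma exists_norm_integral_logKernel_sub_le {α : ℝ} (hα : 1 < α) {γ : ℂ} (hγ : 0 < γ.re) :
    ∃ C, 0 ≤ C ∧ ∀ l : ℝ, 1 ≤ l →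
      ‖(∫ τ : ℝ, logKernel α γ l (τ + (Real.pi / (2 * α) : ℝ) * Complex.I)) -
        Complex.exp (-(Complex.I * Real.pi * γ / 2)) *
          ((1 / ((l * α : ℝ) : ℂ)) ^ γ * Complex.Gamma γ) -
        Complex.exp (Complex.I * l * (1 - α)) * (Complex.exp (Complex.I * Real.pi / 4) *
          Real.sqrt (2 * Real.pi / (α * (α - 1) * l)))‖ ≤
        C * (l ^ (1 - γ.re - α) + l ^ (-(3 / 2) : ℝ)) := by
  have hα0 : 0 < α := by linarith
  have hα1 : 0 < α - 1 := by linarith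
  obtain ⟨c, hc⟩ : ∃ c, c = (α - 1) / (4 * α) := ⟨_, rfl⟩
  have hc0 : 0 < c := by rw [hc]; positivity
  obtain ⟨a₁, ha₁⟩ : ∃ a₁, c * a₁ = Real.pi / (2 * α) := ⟨_, mul_div_cancel₀ _ hc0.ne'⟩
  obtain ⟨a₀, ha₀⟩ : ∃ a₀, c * a₀ = -(Real.pi / 2) := ⟨_, mul_div_cancel₀ _ hc0.ne'⟩
  have ha₀0 : a₀ ≤ 0 := by nlinarith [Real.pi_pos]
  obtain ⟨C₁, hC₁, h₁⟩ := exists_norm_integral_logKernel_Iic_sub_le hα hγ ha₀0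
  obtain ⟨C₂, hC₂, h₂⟩ := exists_norm_integral_saddle_sub_le hα γ hc ha₁ ha₀
  obtain ⟨C₃, hC₃, h₃⟩ := exists_norm_integral_logKernel_Ioi_le hα hγ hc ha₁
  refine ⟨C₁ + C₂ + C₃, by positivity, fun l hl => ?_⟩
  have hl0 : 0 < l := by linarith
  rw [integral_logKernel_eq hα hγ hl0 hc ha₁ ha₀]
  have hp : 0 ≤ l ^ (1 - γ.re - α) := by positivity
  calc _ = ‖((∫ τ in Iic a₀, logKernel α γ l (τ + (-(Real.pi / 2) : ℝ) * Complex.I)) -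
        Complex.exp (-(Complex.I * Real.pi * γ / 2)) *
          ((1 / ((l * α : ℝ) : ℂ)) ^ γ * Complex.Gamma γ)) +
        ((∫ τ in a₀..a₁, (1 + c * Complex.I) * logKernel α γ l ((1 + c * Complex.I) * τ)) -
        Complex.exp (Complex.I * l * (1 - α)) * (Complex.exp (Complex.I * Real.pi / 4) *
          Real.sqrt (2 * Real.pi / (α * (α - 1) * l)))) +
        ∫ τ in Ioi a₁, logKernel α γ l (τ + (Real.pi / (2 * α) : ℝ) * Complex.I)‖ := by
        congr 1; ring
    _ ≤ _ := norm_add₃_le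
    _ ≤ C₁ * (l ^ (1 - γ.re - α) + l ^ (-(3 / 2) : ℝ)) + C₂ * l ^ (-(3 / 2) : ℝ) +
        C₃ * l ^ (-(3 / 2) : ℝ) := by gcongr; exacts [h₁ l hl, h₂ l hl, h₃ l hl]
    _ ≤ _ := by nlinarith [mul_nonneg hC₂ hp, mul_nonneg hC₃ hp]

lemma Gab_eq_integral_logKernel {α : ℝ} (hα : 0 < α) (β : ℂ) (u : ℝ) :
    Gab α β ((α * Real.exp ((α - 1) * u) : ℝ) : ℂ) =
      Complex.exp ((β + 1) * u) * ∫ τ : ℝ, logKernel α (β + 1) (Real.exp (α * u))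
        (τ + (Real.pi / (2 * α) : ℝ) * Complex.I) := by
  have hαC : (α : ℂ) ≠ 0 := by exact_mod_cast hα.ne'
  rw [Gab, integral_Ioi_eq_integral_comp_exp, ← integral_add_right_eq_self _ u,
    ← integral_const_mul, ← integral_const_mul]
  refine integral_congr_ae (Filter.Eventually.of_forall fun τ => ?_)
  simp only
  rw [Complex.cpow_def_of_ne_zero (by exact_mod_cast (Real.exp_pos _).ne'),
    ← Complex.ofReal_log (Real.exp_pos _).le, Real.log_exp, ← Real.exp_mul, logKernel, logPhase]
  have h1 : Complex.exp (α * (τ + (Real.pi / (2 * α) : ℝ) * Complex.I)) =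
      Complex.exp (α * τ) * Complex.I := by
    rw [show α * (τ + (Real.pi / (2 * α) : ℝ) * Complex.I) =
        α * τ + Real.pi / 2 * Complex.I by push_cast; field_simp,
      Complex.exp_add, Complex.exp_pi_div_two_mul_I]
  have h2 : Complex.exp (τ + (Real.pi / (2 * α) : ℝ) * Complex.I) =
      Complex.exp τ * Complex.exp (Complex.I * Real.pi / (2 * α)) := by
    rw [← Complex.exp_add]
    congr 1
    push_cast
    ring
  rw [h1, h2]
  push_cast
  rw [← Complex.exp_add, ← Complex.exp_add, ← Complex.exp_add, ← Complex.exp_add]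
  congr 1
  have h3 : Complex.exp (α * u) * Complex.exp τ =
      Complex.exp ((α - 1) * u) * Complex.exp (τ + u) := by
    rw [← Complex.exp_add, ← Complex.exp_add]
    congr 1
    ring
  have h4 : Complex.exp ((τ + u) * α) = Complex.exp (α * u) * Complex.exp (α * τ) := by
    rw [← Complex.exp_add]
    congr 1
    ring
  rw [h4]
  linear_combination (Complex.I * α * Complex.exp (Complex.I * Real.pi / (2 * α))) * h3 -
    Complex.exp (α * u) * Complex.exp (α * τ) * Complex.I_sq

lemma endpoint_term_eq {α : ℝ} (hα : 0 < α) (γ : ℂ) (u : ℝ) :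
    Complex.exp (γ * u) * (1 / ((Real.exp (α * u) * α : ℝ) : ℂ)) ^ γ =
      ((α * Real.exp ((α - 1) * u) : ℝ) : ℂ) ^ (-γ) := by
  have hx : 0 < α * Real.exp ((α - 1) * u) := by positivity
  have hy : 0 < 1 / (Real.exp (α * u) * α) := by positivity
  rw [show (1 / ((Real.exp (α * u) * α : ℝ) : ℂ)) = ((1 / (Real.exp (α * u) * α) : ℝ) : ℂ) by
      push_cast; rfl,
    Complex.cpow_def_of_ne_zero (by exact_mod_cast hy.ne'),
    Complex.cpow_def_of_ne_zero (by exact_mod_cast hx.ne'),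
    ← Complex.ofReal_log hx.le, ← Complex.ofReal_log hy.le, ← Complex.exp_add,
    Real.log_mul hα.ne' (Real.exp_pos _).ne', one_div, Real.log_inv,
    Real.log_mul (Real.exp_pos _).ne' hα.ne', Real.log_exp, Real.log_exp]
  congr 1
  push_cast
  ring

lemma saddle_phase_eq {α : ℝ} (hα : 1 < α) (u : ℝ) :
    α ^ (-1 / (α - 1)) * (1 - 1 / α) * (α * Real.exp ((α - 1) * u)) ^ (α / (α - 1)) =
      (α - 1) * Real.exp (α * u) := by
  have hα0 : 0 < α := by linarith
  have hα1 : α - 1 ≠ 0 := by linarith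
  rw [Real.mul_rpow hα0.le (Real.exp_pos _).le, ← Real.exp_mul,
    show (α - 1) * u * (α / (α - 1)) = α * u by field_simp]
  have h : α ^ (-1 / (α - 1)) * α ^ (α / (α - 1)) = α := by
    rw [← Real.rpow_add hα0, show -1 / (α - 1) + α / (α - 1) = 1 by field_simp; ring,
      Real.rpow_one]
  calc _ = α ^ (-1 / (α - 1)) * α ^ (α / (α - 1)) * (1 - 1 / α) * Real.exp (α * u) := by ring
    _ = _ := by rw [h]; field_simp

lemma saddle_amplitude_eq {α : ℝ} (hα : 1 < α) (β : ℂ) (u : ℝ) :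
    Complex.exp ((β + 1) * u) *
        (Real.sqrt (2 * Real.pi / (α * (α - 1) * Real.exp (α * u))) : ℂ) =
      (Real.sqrt (2 * Real.pi / (α - 1)) : ℂ) *
        (α : ℂ) ^ ((-1 / 2 - β) / ((α : ℂ) - 1)) *
        ((α * Real.exp ((α - 1) * u) : ℝ) : ℂ) ^ ((β + 1 - (α : ℂ) / 2) / ((α : ℂ) - 1)) := by
  have hα0 : 0 < α := by linarith
  have hα1 : (α : ℂ) - 1 ≠ 0 := by
    exact_mod_cast (show α - 1 ≠ 0 by linarith)
  have hx : 0 < α * Real.exp ((α - 1) * u) := by positivity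
  have hs : Real.sqrt (2 * Real.pi / (α * (α - 1) * Real.exp (α * u))) =
      Real.sqrt (2 * Real.pi / (α - 1)) * Real.exp (-(Real.log α + α * u) / 2) := by
    rw [Real.exp_half, ← Real.sqrt_mul' _ (Real.exp_pos _).le, Real.exp_neg, Real.exp_add,
      Real.exp_log hα0]
    congr 1
    have : α - 1 ≠ 0 := by linarith
    field_simp
  rw [hs, Complex.cpow_def_of_ne_zero (by exact_mod_cast hα0.ne'),
    Complex.cpow_def_of_ne_zero (by exact_mod_cast hx.ne'),
    ← Complex.ofReal_log hx.le, ← Complex.ofReal_log hα0.le,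
    Real.log_mul hα0.ne' (Real.exp_pos _).ne', Real.log_exp]
  push_cast
  rw [mul_left_comm, mul_assoc, ← Complex.exp_add, ← Complex.exp_add]
  congr 2
  field_simp
  ring

lemma exp_mul_rpow_eq {α : ℝ} (hα : 1 < α) (g p u : ℝ) :
    Real.exp (g * u) * Real.exp (α * u) ^ p =
      α ^ (-((g + α * p) / (α - 1))) *
        (α * Real.exp ((α - 1) * u)) ^ ((g + α * p) / (α - 1)) := by
  have hα0 : 0 < α := by linarith
  have hα1 : α - 1 ≠ 0 := by linarith
  rw [Real.mul_rpow hα0.le (Real.exp_pos _).le, ← mul_assoc, ← Real.rpow_add hα0,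
    neg_add_cancel, Real.rpow_zero, one_mul, ← Real.exp_mul, ← Real.exp_mul, ← Real.exp_add]
  congr 1
  field_simp

/-- The two leading terms of the asymptotic expansion of `F_{α,β}` on the
positive real axis. -/
theorem stmt_7 (α : ℝ) (hα : 1 < α) (β : ℂ) (hβ : -1 < β.re) :
    ∃ K x₀ : ℝ, 0 < K ∧ 0 < x₀ ∧ ∀ x : ℝ, x₀ ≤ x →
      ‖Gab α β x -
          Complex.exp (-(Complex.I * Real.pi * (β + 1) / 2)) *
            Complex.Gamma (β + 1) * (x : ℂ) ^ (-(β + 1)) -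
          Complex.exp (Complex.I * Real.pi / 4) *
            (Real.sqrt (2 * Real.pi / (α - 1)) : ℂ) *
            (α : ℂ) ^ ((-1/2 - β) / ((α : ℂ) - 1)) *
            (x : ℂ) ^ ((β + 1 - (α : ℂ) / 2) / ((α : ℂ) - 1)) *
            Complex.exp (-(Complex.I * (↑(α ^ (-1 / (α - 1)) : ℝ) : ℂ) *
              (1 - 1 / (α : ℂ)) * (↑(x ^ (α / (α - 1)) : ℝ) : ℂ)))‖
        ≤ K * (x ^ (-β.re - α - 1) + x ^ ((β.re + 1 - 3 * α / 2) / (α - 1))) := by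
  have hα0 : 0 < α := by linarith
  have hα1 : 0 < α - 1 := by linarith
  have hγ : 0 < (β + 1).re := by simp only [Complex.add_re, Complex.one_re]; linarith
  obtain ⟨C, hC, h⟩ := exists_norm_integral_logKernel_sub_le hα hγ
  set p := ((β + 1).re + α * (1 - (β + 1).re - α)) / (α - 1) with hp
  set q := ((β + 1).re + α * (-(3 / 2))) / (α - 1) with hq
  refine ⟨C * (α ^ (-p) + α ^ (-q)) + 1, α, by positivity, hα0, fun x hx => ?_⟩
  have hx0 : 0 < x := by linarith
  obtain ⟨u, hu0, hu⟩ : ∃ u, 0 ≤ u ∧ x = α * Real.exp ((α - 1) * u) := by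
    refine ⟨Real.log (x / α) / (α - 1),
      div_nonneg (Real.log_nonneg ((one_le_div hα0).2 hx)) hα1.le, ?_⟩
    rw [mul_div_cancel₀ _ hα1.ne', Real.exp_log (by positivity), mul_div_cancel₀ _ hα0.ne']
  have hl : 1 ≤ Real.exp (α * u) := Real.one_le_exp (by positivity)
  have hphase : Complex.I * (↑(α ^ (-1 / (α - 1)) : ℝ) : ℂ) * (1 - 1 / (α : ℂ)) *
      (↑(x ^ (α / (α - 1)) : ℝ) : ℂ) = -(Complex.I * (Real.exp (α * u) : ℝ) * (1 - α)) := by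
    have := congrArg (fun y : ℝ => Complex.I * (y : ℂ)) (saddle_phase_eq hα u)
    rw [← hu] at this
    simp only [Complex.ofReal_mul, Complex.ofReal_sub, Complex.ofReal_div,
      Complex.ofReal_one] at this
    linear_combination this
  have hG := Gab_eq_integral_logKernel hα0 β u
  have hE := endpoint_term_eq hα0 (β + 1) u
  have hS := saddle_amplitude_eq hα β u
  rw [← hu] at hG hE hS
  have hexp : Real.exp (((β + 1).re) * u) * (Real.exp (α * u) ^ (1 - (β + 1).re - α) +
      Real.exp (α * u) ^ (-(3 / 2) : ℝ)) = α ^ (-p) * x ^ p + α ^ (-q) * x ^ q := by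
    rw [mul_add, exp_mul_rpow_eq hα, exp_mul_rpow_eq hα, ← hu]
  have hpe : -β.re - α - 1 = p := by
    rw [hp, eq_div_iff hα1.ne', Complex.add_re, Complex.one_re]
    ring
  have hqe : (β.re + 1 - 3 * α / 2) / (α - 1) = q := by
    rw [hq, Complex.add_re, Complex.one_re]
    ring
  rw [hphase, neg_neg, hG, hpe, hqe]
  calc _ = ‖Complex.exp ((β + 1) * u) *
        ((∫ τ : ℝ, logKernel α (β + 1) (Real.exp (α * u))
            (τ + (Real.pi / (2 * α) : ℝ) * Complex.I)) -
          Complex.exp (-(Complex.I * Real.pi * (β + 1) / 2)) *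
            ((1 / ((Real.exp (α * u) * α : ℝ) : ℂ)) ^ (β + 1) * Complex.Gamma (β + 1)) -
          Complex.exp (Complex.I * (Real.exp (α * u) : ℝ) * (1 - α)) *
            (Complex.exp (Complex.I * Real.pi / 4) *
              Real.sqrt (2 * Real.pi / (α * (α - 1) * Real.exp (α * u)))))‖ := by
        congr 1
        linear_combination (Complex.exp (-(Complex.I * Real.pi * (β + 1) / 2)) *
          Complex.Gamma (β + 1)) * hE + (Complex.exp (Complex.I * Real.pi / 4) *
          Complex.exp (Complex.I * (Real.exp (α * u) : ℝ) * (1 - α))) * hS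
    _ ≤ Real.exp ((β + 1).re * u) * (C * (Real.exp (α * u) ^ (1 - (β + 1).re - α) +
          Real.exp (α * u) ^ (-(3 / 2) : ℝ))) := by
        rw [norm_mul, Complex.norm_exp, Complex.re_mul_ofReal]
        gcongr
        exact h _ hl
    _ = C * (α ^ (-p) * x ^ p + α ^ (-q) * x ^ q) := by rw [← hexp]; ring
    _ ≤ (C * (α ^ (-p) + α ^ (-q)) + 1) * (x ^ p + x ^ q) := by
        have h1 : 0 ≤ C * (α ^ (-p) * x ^ q) := by positivity
        have h2 : 0 ≤ C * (α ^ (-q) * x ^ p) := by positivity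
        have h3 : 0 ≤ x ^ p := by positivity
        have h4 : 0 ≤ x ^ q := by positivity
        nlinarith
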